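/- For p = N the limit of the best Sobolev constants vanishes: lim_{q→∞} λ_q(Ω) = 0, where λ_q(Ω) := inf { ∫_Ω ‖∇u(x)‖^N dx : u smooth with compact support contained in Ω and (∫_Ω |u(x)|^q dx)^{1/q} = 1 }. -/

import Mathlib

open MeasureTheory Filter Topology Metric

noncomputable def lambdaQ {N : ℕ} (Ω : Set (EuclideanSpace ℝ (Fin N))) (p q : ℝ) : ℝ :=
  sInf { c : ℝ | ∃ u : EuclideanSpace ℝ (Fin N) → ℝ,
    ContDiff ℝ (⊤ : ℕ∞) u ∧ HasCompactSupport u ∧ tsupport u ⊆ Ω ∧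
    (∫ x in Ω, |u x| ^ q) ^ (1 / q) = 1 ∧
    c = ∫ x in Ω, ‖gradient u x‖ ^ p }

lemma norm_gradient_eq {N : ℕ} (u : EuclideanSpace ℝ (Fin N) → ℝ) (x : EuclideanSpace ℝ (Fin N)) :
    ‖gradient u x‖ = ‖fderiv ℝ u x‖ := by
  unfold gradient
  exact LinearIsometryEquiv.norm_map _ _

lemma norm_sum_rpow_single {F : Type*} [NormedAddCommGroup F] (s : Finset ℕ) (f : ℕ → F) (p : ℝ)
    (hp : p ≠ 0) (h : ∀ i ∈ s, ∀ j ∈ s, i < j → f i ≠ 0 → f j ≠ 0 → False) :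
    ‖∑ k ∈ s, f k‖ ^ p = ∑ k ∈ s, ‖f k‖ ^ p := by
  by_cases hk : ∃ k ∈ s, f k ≠ 0
  · obtain ⟨k, hks, hk⟩ := hk
    have h0 : ∀ j ∈ s, j ≠ k → f j = 0 := by
      intro j hj hjk
      by_contra hne
      rcases lt_or_gt_of_ne hjk with h1 | h1
      · exact h j hj k hks h1 hne hk
      · exact h k hks j hj h1 hk hne
    rw [Finset.sum_eq_single k h0 (fun h => absurd hks h),
      Finset.sum_eq_single k _ (fun h => absurd hks h)]
    intro j hj hjk
    rw [h0 j hj hjk, norm_zero, Real.zero_rpow hp]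
  · push Not at hk
    rw [Finset.sum_eq_zero hk, norm_zero, Real.zero_rpow hp, Finset.sum_eq_zero]
    intro j hj
    rw [hk j hj, norm_zero, Real.zero_rpow hp]

lemma lambdaQ_nonneg {N : ℕ} (Ω : Set (EuclideanSpace ℝ (Fin N))) (p q : ℝ) :
    0 ≤ lambdaQ Ω p q := by
  apply Real.sInf_nonneg
  rintro c ⟨u, -, -, -, -, rfl⟩
  exact integral_nonneg fun x => Real.rpow_nonneg (norm_nonneg _) _

lemma lambdaQ_le {N : ℕ} (Ω : Set (EuclideanSpace ℝ (Fin N))) (p : ℝ) (hp : 0 < p)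
    (u : EuclideanSpace ℝ (Fin N) → ℝ) (hu : ContDiff ℝ (⊤ : ℕ∞) u) (hc : HasCompactSupport u)
    (hs : tsupport u ⊆ Ω) (x₀ : EuclideanSpace ℝ (Fin N)) (ρ : ℝ) (hρ : 0 < ρ)
    (hA : ball x₀ ρ ⊆ Ω) (h2 : ∀ x ∈ ball x₀ ρ, u x = 2) :
    ∀ᶠ q in atTop, lambdaQ Ω p q ≤ ∫ x, ‖fderiv ℝ u x‖ ^ p := by
  have hm : 0 < volume.real (ball x₀ ρ) :=
    ENNReal.toReal_pos (measure_ball_pos _ _ hρ).ne' measure_ball_lt_top.ne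
  have hlim : Tendsto (fun q : ℝ => (2:ℝ) ^ q * volume.real (ball x₀ ρ)) atTop atTop :=
    (tendsto_rpow_atTop_of_base_gt_one 2 (by norm_num)).atTop_mul_const hm
  filter_upwards [hlim.eventually_ge_atTop 1, eventually_gt_atTop 0] with q hq hq0
  have hint : Integrable (fun x => |u x| ^ q) := by
    apply Continuous.integrable_of_hasCompactSupport
    · exact (hu.continuous.abs).rpow_const fun x => Or.inr hq0.le
    · exact hc.comp_left (g := fun y : ℝ => |y| ^ q) (by simp [hq0.ne'])
  set I := ∫ x in Ω, |u x| ^ q with hI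
  have hI1 : 1 ≤ I := by
    refine hq.trans ?_
    have h1 : ∫ x in ball x₀ ρ, |u x| ^ q = 2 ^ q * volume.real (ball x₀ ρ) := by
      rw [setIntegral_congr_fun (g := fun _ => (2:ℝ) ^ q) measurableSet_ball]
      · simp [mul_comm]
      · intro x hx
        simp [h2 x hx]
    rw [← h1]
    exact setIntegral_mono_set hint.integrableOn
      (Eventually.of_forall fun x => Real.rpow_nonneg (abs_nonneg _) _) hA.eventuallyLE
  set t := I ^ (1 / q) with ht
  have ht1 : 1 ≤ t := Real.one_le_rpow hI1 (by positivity)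
  have ht0 : 0 < t := by linarith
  have hint2 : Integrable (fun x => ‖fderiv ℝ u x‖ ^ p) := by
    apply Continuous.integrable_of_hasCompactSupport
    · exact ((hu.continuous_fderiv (by simp)).norm).rpow_const fun x => Or.inr hp.le
    · exact (hc.fderiv (𝕜 := ℝ)).comp_left (g := fun y => ‖y‖ ^ p) (by simp [hp.ne'])
  have hd : ∀ x, ‖gradient (fun x => t⁻¹ * u x) x‖ = t⁻¹ * ‖fderiv ℝ u x‖ := by
    intro x
    rw [norm_gradient_eq, fderiv_const_mul (hu.differentiable (by simp) x), norm_smul,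
      Real.norm_of_nonneg (by positivity)]
  calc lambdaQ Ω p q ≤ ∫ x in Ω, ‖gradient (fun x => t⁻¹ * u x) x‖ ^ p := by
        apply csInf_le
        · refine ⟨0, ?_⟩
          rintro c ⟨u, -, -, -, -, rfl⟩
          exact integral_nonneg fun x => Real.rpow_nonneg (norm_nonneg _) _
        · refine ⟨_, contDiff_const.mul hu, hc.mul_left, ?_, ?_, rfl⟩
          · exact (tsupport_mul_subset_right).trans hs
          · have : ∀ x, |t⁻¹ * u x| ^ q = I⁻¹ * |u x| ^ q := by
              intro x
              rw [abs_mul, Real.mul_rpow (abs_nonneg _) (abs_nonneg _), abs_of_pos (by positivity),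
                Real.inv_rpow ht0.le, ht, ← Real.rpow_mul (by linarith),
                one_div_mul_cancel hq0.ne', Real.rpow_one]
            simp_rw [this]
            rw [integral_const_mul, ← hI, inv_mul_cancel₀ (by linarith), Real.one_rpow]
    _ ≤ ∫ x in Ω, ‖fderiv ℝ u x‖ ^ p := by
        apply integral_mono_of_nonneg
        · exact Eventually.of_forall fun x => Real.rpow_nonneg (norm_nonneg _) _
        · exact hint2.integrableOn
        · refine Eventually.of_forall fun x => ?_
          simp only [hd]
          apply Real.rpow_le_rpow (by positivity) _ hp.le
          exact mul_le_of_le_one_left (norm_nonneg _) (inv_le_one_of_one_le₀ ht1)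
    _ ≤ _ := setIntegral_le_integral hint2
        (Eventually.of_forall fun x => Real.rpow_nonneg (norm_nonneg _) _)

lemma exists_test {N : ℕ} (hN : 2 ≤ N) (x₀ : EuclideanSpace ℝ (Fin N)) (r : ℝ) (hr : 0 < r) :
    ∃ C : ℝ, ∀ n : ℕ, 0 < n → ∃ u : EuclideanSpace ℝ (Fin N) → ℝ,
      ContDiff ℝ (⊤ : ℕ∞) u ∧ tsupport u ⊆ closedBall x₀ (r / 2) ∧
      (∃ ρ > 0, ρ ≤ r ∧ ∀ x ∈ ball x₀ ρ, u x = 2) ∧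
      ∫ x, ‖fderiv ℝ u x‖ ^ (N : ℝ) = (2 / n) ^ (N : ℝ) * (n * C) := by
  have hN0 : (N : ℝ) ≠ 0 := by positivity
  let φ : ContDiffBump (0 : EuclideanSpace ℝ (Fin N)) := ⟨1, 2, by norm_num, by norm_num⟩
  have hφs : ContDiff ℝ (⊤ : ℕ∞) φ := φ.contDiff
  have hφd : ∀ y, fderiv ℝ φ y ≠ 0 → 1 ≤ ‖y‖ ∧ ‖y‖ ≤ 2 := by
    intro y hy
    constructor
    · by_contra! h
      apply hy
      have : (φ : _ → ℝ) =ᶠ[𝓝 y] fun _ => 1 := by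
        filter_upwards [isOpen_ball.mem_nhds (mem_ball_zero_iff.2 h)] with z hz
        exact φ.one_of_mem_closedBall (ball_subset_closedBall hz)
      rw [this.fderiv_eq]; simp
    · have := support_fderiv_subset ℝ (f := φ) hy
      rw [φ.tsupport_eq] at this
      simpa using this
  have hint : Integrable (fun y => ‖fderiv ℝ φ y‖ ^ (N : ℝ)) := by
    apply Continuous.integrable_of_hasCompactSupport
    · exact ((hφs.continuous_fderiv (by simp)).norm).rpow_const fun x => Or.inr (by positivity)
    · exact (φ.hasCompactSupport.fderiv (𝕜 := ℝ)).comp_left (g := fun y => ‖y‖ ^ (N : ℝ)) 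
        (by simp; omega)
  refine ⟨∫ y, ‖fderiv ℝ φ y‖ ^ (N : ℝ), fun n hn => ?_⟩
  let c : ℕ → ℝ := fun k => 4 ^ k * (4 / r)
  have hc : ∀ k, 0 < c k := fun k => by positivity
  have hcm : ∀ i j, i < j → 4 * c i ≤ c j := by
    intro i j hij
    have : (4:ℝ) ^ (i + 1) ≤ 4 ^ j := pow_le_pow_right₀ (by norm_num) hij
    calc 4 * c i = 4 ^ (i+1) * (4 / r) := by simp only [c]; ring
      _ ≤ _ := by simp only [c]; gcongr
  have hc0 : ∀ k, 4 / r ≤ c k := fun k =>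
    le_mul_of_one_le_left (by positivity) (one_le_pow₀ (by norm_num))
  have hn' : (0:ℝ) < n := by exact_mod_cast hn
  let g : ℕ → EuclideanSpace ℝ (Fin N) → ℝ := fun k x => φ (c k • (x - x₀))
  have hgs : ∀ k, ContDiff ℝ (⊤ : ℕ∞) (g k) := fun k =>
    hφs.comp ((contDiff_id.sub contDiff_const).const_smul (c k))
  have hgd : ∀ k x, fderiv ℝ (g k) x = c k • fderiv ℝ φ (c k • (x - x₀)) := by
    intro k x
    have h1 : HasFDerivAt (fun x => c k • (x - x₀))
        (c k • ContinuousLinearMap.id ℝ (EuclideanSpace ℝ (Fin N))) x :=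
      ((hasFDerivAt_id x).sub_const x₀).const_smul (c k)
    have h2 := ((hφs.differentiable (by simp) (c k • (x - x₀))).hasFDerivAt).comp x h1
    have h3 := h2.fderiv
    ext v
    change fderiv ℝ (φ ∘ fun x => c k • (x - x₀)) x v = _
    rw [h3]
    simp
  have hgi : ∀ k, Integrable (fun x => ‖fderiv ℝ (g k) x‖ ^ (N : ℝ)) ∧
      ∫ x, ‖fderiv ℝ (g k) x‖ ^ (N : ℝ) = ∫ y, ‖fderiv ℝ φ y‖ ^ (N : ℝ) := by
    intro k
    have e : (fun x => ‖fderiv ℝ (g k) x‖ ^ (N : ℝ)) =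
        fun x => (fun z => c k ^ N * (fun y => ‖fderiv ℝ φ y‖ ^ (N : ℝ)) (c k • z)) (x - x₀) := by
      funext x
      simp only [hgd, norm_smul, Real.norm_of_nonneg (hc k).le]
      rw [Real.mul_rpow (hc k).le (norm_nonneg _), Real.rpow_natCast (c k)]
    rw [e]
    constructor
    · exact ((hint.comp_smul (hc k).ne').const_mul _).comp_sub_right x₀
    · rw [integral_sub_right_eq_self (fun z => c k ^ N * (fun y => ‖fderiv ℝ φ y‖ ^ (N : ℝ)) (c k • z)) x₀,
        integral_const_mul, Measure.integral_comp_smul volume (fun y => ‖fderiv ℝ φ y‖ ^ (N : ℝ)) (c k), finrank_euclideanSpace_fin,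
        abs_of_pos (by have := hc k; positivity), smul_eq_mul, ← mul_assoc,
        mul_inv_cancel₀ (pow_pos (hc k) N).ne', one_mul]
  refine ⟨fun x => (2 / n) * ∑ k ∈ Finset.range n, g k x, ?_, ?_, ?_, ?_⟩
  · exact contDiff_const.mul (ContDiff.sum fun k _ => hgs k)
  · apply closure_minimal _ isClosed_closedBall
    intro x hx
    by_contra hxn
    apply hx
    rw [mem_closedBall, dist_eq_norm, not_le] at hxn
    simp only
    rw [Finset.sum_eq_zero, mul_zero]
    intro k _
    apply φ.zero_of_le_dist
    rw [dist_zero_right, norm_smul, Real.norm_of_nonneg (hc k).le]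
    calc (2:ℝ) = 4 / r * (r / 2) := by field_simp; norm_num
      _ ≤ c k * ‖x - x₀‖ := mul_le_mul (hc0 k) hxn.le (by positivity) (hc k).le
  · have hcn : ∀ k < n, c k ≤ c n := fun k hk => by
      have := hcm k n hk; have := hc k; linarith
    refine ⟨(c n)⁻¹, inv_pos.2 (hc n), ?_, ?_⟩
    · calc (c n)⁻¹ ≤ (4 / r)⁻¹ := inv_anti₀ (by positivity) (hc0 n)
        _ ≤ r := by rw [inv_div]; linarith
    · intro x hx
      rw [mem_ball, dist_eq_norm] at hx
      have : ∀ k ∈ Finset.range n, g k x = 1 := by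
        intro k hk
        apply φ.one_of_mem_closedBall
        rw [mem_closedBall_zero_iff, norm_smul, Real.norm_of_nonneg (hc k).le]
        calc c k * ‖x - x₀‖ ≤ c n * (c n)⁻¹ :=
              mul_le_mul (hcn k (Finset.mem_range.1 hk)) hx.le (norm_nonneg _) (hc n).le
          _ = 1 := mul_inv_cancel₀ (hc n).ne'
      simp only
      rw [Finset.sum_congr rfl this]
      simp
      field_simp
  · have hpt : ∀ x, ‖fderiv ℝ (fun x => (2 / (n:ℝ)) * ∑ k ∈ Finset.range n, g k x) x‖ ^ (N:ℝ) =
        (2 / (n:ℝ)) ^ (N:ℝ) * ∑ k ∈ Finset.range n, ‖fderiv ℝ (g k) x‖ ^ (N : ℝ) := by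
      intro x
      have hdk : ∀ k ∈ Finset.range n, DifferentiableAt ℝ (g k) x :=
        fun k _ => (hgs k).differentiable (by simp) x
      rw [fderiv_const_mul (DifferentiableAt.fun_sum hdk), fderiv_fun_sum hdk, norm_smul,
        Real.norm_of_nonneg (by positivity), Real.mul_rpow (by positivity) (norm_nonneg _),
        norm_sum_rpow_single _ _ _ hN0]
      intro i _ j _ hij hi hj
      rw [hgd] at hi hj
      have h1 := (hφd _ (right_ne_zero_of_smul hi)).1
      have h2 := (hφd _ (right_ne_zero_of_smul hj)).2
      rw [norm_smul, Real.norm_of_nonneg (hc _).le] at h1 h2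
      have := mul_le_mul_of_nonneg_right (hcm i j hij) (norm_nonneg (x - x₀))
      nlinarith
    simp_rw [hpt]
    rw [integral_const_mul, integral_finsetSum _ fun k _ => (hgi k).1]
    simp only [(hgi _).2]
    simp

theorem stmt14 {N : ℕ} (hN : 2 ≤ N) (Ω : Set (EuclideanSpace ℝ (Fin N)))
    (hΩo : IsOpen Ω) (hΩb : Bornology.IsBounded Ω) (hΩne : Ω.Nonempty) :
    Tendsto (fun q => lambdaQ Ω (N : ℝ) q) atTop (𝓝 0) := by
  obtain ⟨x₀, hx₀⟩ := hΩne
  obtain ⟨r, hr, hball⟩ := Metric.isOpen_iff.1 hΩo x₀ hx₀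
  obtain ⟨C, hC⟩ := exists_test hN x₀ r hr
  have hlim : Tendsto (fun n : ℕ => (2 / (n:ℝ)) ^ (N : ℝ) * (n * C)) atTop (𝓝 0) := by
    obtain ⟨M, rfl⟩ : ∃ M, N = M + 2 := ⟨N - 2, by omega⟩
    have h1 : Tendsto (fun n : ℕ => 2 / (n:ℝ)) atTop (𝓝 0) :=
      tendsto_const_div_atTop_nhds_zero_nat 2
    have h2 : Tendsto (fun n : ℕ => (2 / (n:ℝ)) ^ (M + 1) * (2 * C)) atTop (𝓝 0) := by
      have := (h1.pow (M + 1)).mul_const (2 * C)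
      simpa using this
    refine h2.congr' ?_
    filter_upwards [eventually_gt_atTop 0] with n hn
    have : (n : ℝ) ≠ 0 := by positivity
    rw [Real.rpow_natCast, pow_succ _ (M + 1)]
    field_simp
  rw [tendsto_order]
  refine ⟨fun a ha => Eventually.of_forall fun q => ha.trans_le (lambdaQ_nonneg _ _ _), ?_⟩
  intro ε hε
  obtain ⟨n, hn, hn0⟩ := ((hlim.eventually_lt_const hε).and (eventually_gt_atTop 0)).exists
  obtain ⟨u, hu, hs, ⟨ρ, hρ, hρr, h2⟩, hI⟩ := hC n hn0
  have hcpt : HasCompactSupport u :=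
    (isCompact_closedBall x₀ (r / 2)).of_isClosed_subset (isClosed_tsupport u) hs
  have := lambdaQ_le Ω (N : ℝ) (by exact_mod_cast (by omega : 0 < N)) u hu hcpt
    (hs.trans ((closedBall_subset_ball (by linarith)).trans hball)) x₀ ρ hρ
    ((ball_subset_ball hρr).trans hball) h2
  filter_upwards [this] with q hq
  rw [hI] at hq
  exact hq.trans_lt hn
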